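/- arXiv:2211.12793 — 2 statements merged into one kernel-verified Lean document; each statement's English description precedes it below -/
import Mathlib

section
/- For every quaternion matrix Q ∈ ℍ^{M×N} there exist quaternion matrices U ∈ ℍ^{M×M} and V ∈ ℍ^{N×N} with UᴴU = UUᴴ = I_M and VᴴV = VVᴴ = I_N (i.e., U and V are unitary), and a quaternion matrix Λ ∈ ℍ^{M×N} such that Λ(i,j) = 0 whenever i ≠ j, every diagonal entry Λ(i,i) equals σ_i·1 for some real number σ_i ≥ 0, and Q = U Λ Vᴴ (quaternion singular value decomposition, QSVD). -/
open Matrix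

def QUni {n : ℕ} (U : Matrix (Fin n) (Fin n) (Quaternion ℝ)) : Prop := Uᴴ * U = 1 ∧ U * Uᴴ = 1

def QP {M N : ℕ} (k : ℕ) (A : Matrix (Fin M) (Fin N) (Quaternion ℝ)) : Prop :=
  ∀ (i : Fin M) (j : Fin N), ((i : ℕ) < k ∨ (j : ℕ) < k) →
    ((i : ℕ) ≠ (j : ℕ) → A i j = 0) ∧
    ((i : ℕ) = (j : ℕ) → A i j = ((‖A i j‖ : ℝ) : Quaternion ℝ))

lemma QUni.mul {n : ℕ} {U V : Matrix (Fin n) (Fin n) (Quaternion ℝ)} (hU : QUni U) (hV : QUni V) :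
    QUni (U * V) := by
  constructor
  · rw [conjTranspose_mul, Matrix.mul_assoc, ← Matrix.mul_assoc _ U V, hU.1, Matrix.one_mul, hV.1]
  · rw [conjTranspose_mul, Matrix.mul_assoc, ← Matrix.mul_assoc V, hV.2, Matrix.one_mul, hU.2]

lemma QUni.star {n : ℕ} {U : Matrix (Fin n) (Fin n) (Quaternion ℝ)} (hU : QUni U) : QUni Uᴴ := by
  constructor
  · rw [conjTranspose_conjTranspose, hU.2]
  · rw [conjTranspose_conjTranspose, hU.1]

lemma QUni.one {n : ℕ} : QUni (1 : Matrix (Fin n) (Fin n) (Quaternion ℝ)) := by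
  constructor <;> simp

lemma QP.star {M N k : ℕ} {A : Matrix (Fin M) (Fin N) (Quaternion ℝ)} (h : QP k A) :
    QP k Aᴴ := by
  intro i j hij
  obtain ⟨h1, h2⟩ := h j i hij.symm
  constructor
  · intro hne
    simp [conjTranspose_apply, h1 (Ne.symm hne)]
  · intro he
    have := h2 he.symm
    rw [conjTranspose_apply, norm_star, this]
    simp

lemma QUni.norm_le {n : ℕ} {U : Matrix (Fin n) (Fin n) (Quaternion ℝ)} (hU : QUni U)
    (i j : Fin n) : ‖U i j‖ ≤ 1 := by
  have h := congrFun (congrFun hU.2 i) i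
  rw [Matrix.mul_apply] at h
  have h2 : ∑ x, ‖U i x‖ ^ 2 = 1 := by
    have h3 : ((∑ x, ‖U i x‖ ^ 2 : ℝ) : Quaternion ℝ) = ((1 : ℝ) : Quaternion ℝ) := by
      rw [← Quaternion.algebraMap_def, map_sum]
      simp only [conjTranspose_apply, one_apply_eq, Quaternion.self_mul_star] at h
      simp only [Quaternion.normSq_eq_norm_mul_self, ← pow_two] at h
      simpa using h
    exact Quaternion.coe_injective h3
  have h4 : ‖U i j‖ ^ 2 ≤ ∑ x, ‖U i x‖ ^ 2 :=
    Finset.single_le_sum (f := fun x => ‖U i x‖ ^ 2) (fun _ _ => by positivity) (Finset.mem_univ j)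
  rw [h2] at h4
  nlinarith [norm_nonneg (U i j)]

lemma QUni.isCompact (n : ℕ) :
    IsCompact {U : Matrix (Fin n) (Fin n) (Quaternion ℝ) | QUni U} := by
  have : ProperSpace (Quaternion ℝ) := FiniteDimensional.proper ℝ _
  have hc : IsCompact (Set.pi Set.univ (fun _ : Fin n => Set.pi Set.univ
      (fun _ : Fin n => Metric.closedBall (0 : Quaternion ℝ) 1))) :=
    isCompact_univ_pi fun _ => isCompact_univ_pi fun _ => isCompact_closedBall _ _
  refine IsCompact.of_isClosed_subset hc ?_ ?_
  · refine IsClosed.inter ?_ ?_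
    · exact isClosed_eq (by fun_prop) continuous_const
    · exact isClosed_eq (by fun_prop) continuous_const
  · intro U hU i _ j _
    simpa using QUni.norm_le hU i j

lemma QP.isClosed {M N : ℕ} (k : ℕ) :
    IsClosed {A : Matrix (Fin M) (Fin N) (Quaternion ℝ) | QP k A} := by
  unfold QP
  simp only [Set.ofPred_forall, Set.ofPred_and]
  have hc : ∀ (i : Fin M) (j : Fin N), Continuous
      (fun A : Matrix (Fin M) (Fin N) (Quaternion ℝ) => A i j) := by
    intro i j; fun_prop
  refine isClosed_iInter fun i => isClosed_iInter fun j => isClosed_iInter fun _ =>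
    IsClosed.inter (isClosed_iInter fun _ => isClosed_eq (hc i j) continuous_const)
      (isClosed_iInter fun _ => isClosed_eq (hc i j) ?_)
  exact Quaternion.continuous_coe.comp (continuous_norm.comp (hc i j))

/-- phase -/
noncomputable def QD {n : ℕ} (k : Fin n) (u : Quaternion ℝ) : Matrix (Fin n) (Fin n) (Quaternion ℝ) :=
  Matrix.diagonal (fun i => if i = k then u else 1)

lemma QD.uni {n : ℕ} (k : Fin n) (u : Quaternion ℝ) (h1 : star u * u = 1) (h2 : u * star u = 1) :
    QUni (QD k u) := by
  constructor
  · rw [QD, diagonal_conjTranspose, diagonal_mul_diagonal, ← diagonal_one]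
    congr 1; funext i
    by_cases h : i = k <;> simp [h, h1]
  · rw [QD, diagonal_conjTranspose, diagonal_mul_diagonal, ← diagonal_one]
    congr 1; funext i
    by_cases h : i = k <;> simp [h, h2]

noncomputable def QG {n : ℕ} (k l : Fin n) (c : ℝ) (s : Quaternion ℝ) : Matrix (Fin n) (Fin n) (Quaternion ℝ) :=
  fun i j => if i = k then (if j = k then (c : Quaternion ℝ) else if j = l then star s else 0)
    else if i = l then (if j = k then -s else if j = l then (c : Quaternion ℝ) else 0)
    else if i = j then 1 else 0

lemma QG.mul_apply {n N : ℕ} {k l : Fin n} (hkl : k ≠ l) (c : ℝ) (s : Quaternion ℝ)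
    (A : Matrix (Fin n) (Fin N) (Quaternion ℝ)) (i : Fin n) (j : Fin N) :
    (QG k l c s * A) i j = if i = k then (c : Quaternion ℝ) * A k j + star s * A l j
      else if i = l then - s * A k j + (c : Quaternion ℝ) * A l j else A i j := by
  have key : ∀ a b : Quaternion ℝ, ∑ x, (if x = k then a else if x = l then b else 0) * A x j
      = a * A k j + b * A l j := by
    intro a b
    rw [Fintype.sum_eq_add k l hkl]
    · simp [hkl.symm]
    · rintro x ⟨h1, h2⟩; simp [h1, h2]
  rw [Matrix.mul_apply]
  unfold QG
  by_cases h1 : i = k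
  · simp only [h1, if_true]; exact key _ _
  · by_cases h2 : i = l
    · simp only [h2, hkl.symm, if_true, if_false]; exact key _ _
    · simp [h1, h2]

lemma QG.star_eq {n : ℕ} {k l : Fin n} (hkl : k ≠ l) (c : ℝ) (s : Quaternion ℝ) :
    (QG k l c s)ᴴ = QG k l c (-s) := by
  ext1 i j
  rw [conjTranspose_apply]
  unfold QG
  by_cases h1 : i = k <;> by_cases h2 : i = l <;> by_cases h3 : j = k <;> by_cases h4 : j = l <;>
    simp_all [eq_comm]
  split_ifs <;> simp

lemma QG.mul_star {n : ℕ} {k l : Fin n} (hkl : k ≠ l) (c : ℝ) (s : Quaternion ℝ)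
    (h : c ^ 2 + ‖s‖ ^ 2 = 1) : QG k l c s * QG k l c (-s) = 1 := by
  have hc : (c : Quaternion ℝ) * c + star s * s = 1 := by
    rw [Quaternion.star_mul_self, Quaternion.normSq_eq_norm_mul_self]
    rw [pow_two, pow_two] at h
    exact_mod_cast congrArg (fun x : ℝ => (x : Quaternion ℝ)) h
  have hc' : s * star s + (c : Quaternion ℝ) * c = 1 := by
    rw [Quaternion.self_mul_star, ← Quaternion.star_mul_self, add_comm, hc]
  have hcs : (c : Quaternion ℝ) * s = s * c := (Quaternion.coe_commutes c s)
  have hcs' : (c : Quaternion ℝ) * star s = star s * c := (Quaternion.coe_commutes c (star s))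
  ext1 i j
  rw [QG.mul_apply hkl]
  unfold QG
  by_cases h1 : i = k <;> by_cases h2 : i = l <;> by_cases h3 : j = k <;> by_cases h4 : j = l <;>
    simp_all [eq_comm, Matrix.one_apply]

lemma QG.uni {n : ℕ} {k l : Fin n} (hkl : k ≠ l) (c : ℝ) (s : Quaternion ℝ)
    (h : c ^ 2 + ‖s‖ ^ 2 = 1) : QUni (QG k l c s) := by
  rw [QUni, QG.star_eq hkl]
  refine ⟨?_, QG.mul_star hkl c s h⟩
  have := QG.mul_star hkl c (-s) (by simpa using h)
  simpa using this

lemma QP.of_rows {M N k : ℕ} {A B : Matrix (Fin M) (Fin N) (Quaternion ℝ)} (h : QP k A)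
    (h1 : ∀ (i : Fin M) (j : Fin N), (i : ℕ) < k → B i j = A i j)
    (h2 : ∀ (i : Fin M) (j : Fin N), k ≤ (i : ℕ) → (j : ℕ) < k → B i j = 0) : QP k B := by
  intro i j hij
  by_cases hi : (i : ℕ) < k
  · rw [h1 i j hi]; exact h i j hij
  · have hj : (j : ℕ) < k := by omega
    rw [h2 i j (by omega) hj]
    simp

lemma Q_left {M N : ℕ} (A : Matrix (Fin M) (Fin N) (Quaternion ℝ)) (k : Fin M) (k' : Fin N)
    (hk : (k : ℕ) = k') (hP : QP k A)
    (hmax : ∀ X : Matrix (Fin M) (Fin M) (Quaternion ℝ), QUni X → QP k (X * A) → ((X * A) k k').re ≤ (A k k').re) :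
    A k k' = ((‖A k k'‖ : ℝ) : Quaternion ℝ) ∧ ∀ l : Fin M, (k : ℕ) < l → A l k' = 0 := by
  have hz : ∀ (i : Fin M) (j : Fin N), (k : ℕ) ≤ i → (j : ℕ) < k → A i j = 0 :=
    fun i j hi hj => (hP i j (Or.inr hj)).1 (by omega)
  have hph : A k k' = ((‖A k k'‖ : ℝ) : Quaternion ℝ) := by
    by_cases h0 : A k k' = 0
    · simp [h0]
    set p := A k k' with hp
    have hn : ‖p‖ ≠ 0 := norm_ne_zero_iff.mpr h0
    set u : Quaternion ℝ := ((‖p‖⁻¹ : ℝ) : Quaternion ℝ) * star p with hu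
    have hup : u * p = ((‖p‖ : ℝ) : Quaternion ℝ) := by
      rw [hu, mul_assoc, Quaternion.star_mul_self, Quaternion.normSq_eq_norm_mul_self,
        ← Quaternion.coe_mul]
      congr 1; field_simp
    have hnu : ‖u‖ = 1 := by
      rw [hu, norm_mul, norm_star, Quaternion.norm_coe, norm_inv, norm_norm]
      field_simp
    have hu1 : star u * u = 1 := by
      rw [Quaternion.star_mul_self, Quaternion.normSq_eq_norm_mul_self, hnu]; simp
    have hu2 : u * star u = 1 := by
      rw [Quaternion.self_mul_star, Quaternion.normSq_eq_norm_mul_self, hnu]; simp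
    have hX : ∀ i j, (QD k u * A) i j = (if i = k then u else 1) * A i j := by
      intro i j; rw [QD, Matrix.diagonal_mul]
    have hle := hmax (QD k u) (QD.uni k u hu1 hu2) (hP.of_rows
      (fun i j hi => by
        have : i ≠ k := by rintro rfl; omega
        rw [hX]; simp [this])
      (fun i j hi hj => by rw [hX, hz i j hi hj, mul_zero]))
    rw [hX, if_pos rfl, ← hp, hup, Quaternion.re_coe] at hle
    have hsq : ‖p‖ * ‖p‖ = p.re ^ 2 + p.imI ^ 2 + p.imJ ^ 2 + p.imK ^ 2 := by
      rw [← Quaternion.normSq_eq_norm_mul_self, Quaternion.normSq_def']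
    have hnn := norm_nonneg p
    have hre : p.re = ‖p‖ := by
      nlinarith [sq_nonneg p.imI, sq_nonneg p.imJ, sq_nonneg p.imK]
    rw [hre] at hsq
    have hI : p.imI = 0 := by
      apply pow_eq_zero_iff (two_ne_zero) |>.1
      nlinarith [sq_nonneg p.imI, sq_nonneg p.imJ, sq_nonneg p.imK]
    have hJ : p.imJ = 0 := by
      apply pow_eq_zero_iff (two_ne_zero) |>.1
      nlinarith [sq_nonneg p.imI, sq_nonneg p.imJ, sq_nonneg p.imK]
    have hK : p.imK = 0 := by
      apply pow_eq_zero_iff (two_ne_zero) |>.1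
      nlinarith [sq_nonneg p.imI, sq_nonneg p.imJ, sq_nonneg p.imK]
    apply Quaternion.ext <;> simp [hre, hI, hJ, hK]
  refine ⟨hph, fun l hl => ?_⟩
  by_contra hq
  set q := A l k' with hqd
  set t := ‖A k k'‖ with ht
  have hkl : k ≠ l := by rintro rfl; omega
  have hqn : 0 < ‖q‖ := norm_pos_iff.mpr hq
  have ht0 : 0 ≤ t := norm_nonneg _
  set r := Real.sqrt (t ^ 2 + ‖q‖ ^ 2) with hr
  have hr2 : r ^ 2 = t ^ 2 + ‖q‖ ^ 2 := Real.sq_sqrt (by positivity)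
  have hr0 : 0 < r := Real.sqrt_pos.mpr (by positivity)
  have hle := hmax (QG k l (t / r) (((r⁻¹ : ℝ) : Quaternion ℝ) * q))
    (QG.uni hkl _ _ (by
      rw [norm_mul, Quaternion.norm_coe, norm_inv, Real.norm_of_nonneg hr0.le]
      field_simp; rw [hr2]))
    (hP.of_rows
      (fun i j hi => by
        have h1 : i ≠ k := by rintro rfl; omega
        have h2 : i ≠ l := by rintro rfl; omega
        rw [QG.mul_apply hkl]; simp [h1, h2])
      (fun i j hi hj => by
        rw [QG.mul_apply hkl, hz k j le_rfl hj, hz l j hl.le hj, hz i j hi hj]; simp))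
  rw [QG.mul_apply hkl, if_pos rfl, hph, ← hqd, star_mul, Quaternion.star_coe,
    ← Quaternion.coe_commutes (r⁻¹) (star q), mul_assoc, Quaternion.star_mul_self,
    Quaternion.normSq_eq_norm_mul_self, ← Quaternion.coe_mul, ← Quaternion.coe_mul,
    ← Quaternion.coe_add, Quaternion.re_coe, Quaternion.re_coe] at hle
  have : t / r * t + r⁻¹ * (‖q‖ * ‖q‖) = r := by
    field_simp; linarith
  rw [this] at hle
  nlinarith

lemma Q_step {M N : ℕ} (Q : Matrix (Fin M) (Fin N) (Quaternion ℝ)) (k : ℕ) :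
    ∃ (U : Matrix (Fin M) (Fin M) (Quaternion ℝ)) (V : Matrix (Fin N) (Fin N) (Quaternion ℝ)),
      QUni U ∧ QUni V ∧ QP k (Uᴴ * Q * V) := by
  induction k with
  | zero => exact ⟨1, 1, QUni.one, QUni.one, fun i j h => by omega⟩
  | succ k ih =>
    obtain ⟨U₀, V₀, hU₀, hV₀, hP₀⟩ := ih
    by_cases hkM : k < M
    swap
    · refine ⟨U₀, V₀, hU₀, hV₀, fun i j h => ?_⟩
      by_cases hij : (i : ℕ) < k ∨ (j : ℕ) < k
      · exact hP₀ i j hij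
      · omega
    by_cases hkN : k < N
    swap
    · refine ⟨U₀, V₀, hU₀, hV₀, fun i j h => ?_⟩
      by_cases hij : (i : ℕ) < k ∨ (j : ℕ) < k
      · exact hP₀ i j hij
      · omega
    let F : Matrix (Fin M) (Fin M) (Quaternion ℝ) × Matrix (Fin N) (Fin N) (Quaternion ℝ) →
      Matrix (Fin M) (Fin N) (Quaternion ℝ) := fun W => W.1ᴴ * Q * W.2
    have hF : Continuous F := by
      show Continuous fun W : Matrix (Fin M) (Fin M) (Quaternion ℝ) ×
        Matrix (Fin N) (Fin N) (Quaternion ℝ) => W.1ᴴ * Q * W.2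
      fun_prop
    let a : Fin M := ⟨k, hkM⟩
    let b : Fin N := ⟨k, hkN⟩
    have hcomp : IsCompact (({U | QUni U} ×ˢ {V | QUni V}) ∩ F ⁻¹' {A | QP k A}) :=
      ((QUni.isCompact M).prod (QUni.isCompact N)).inter_right ((QP.isClosed k).preimage hF)
    have hre : Continuous fun W => (F W a b).re :=
      Quaternion.continuous_re.comp (hF.matrix_elem a b)
    obtain ⟨⟨U, V⟩, ⟨⟨hU, hV⟩, hP⟩, hm⟩ := hcomp.exists_isMaxOn
      ⟨(U₀, V₀), ⟨hU₀, hV₀⟩, hP₀⟩ hre.continuousOn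
    simp only [Set.mem_ofPred_eq, Set.mem_preimage] at hU hV hP
    refine ⟨U, V, hU, hV, ?_⟩
    change QP (k+1) (F (U, V))
    set A := F (U, V) with hA
    have hL := Q_left A a b rfl hP (by
      intro X hX hXP
      have he : F (U * Xᴴ, V) = X * A := by
        simp [F, hA, conjTranspose_mul, Matrix.mul_assoc]
      have := hm (a := (U * Xᴴ, V)) ⟨⟨hU.mul hX.star, hV⟩, by
        rw [Set.mem_preimage, he]; exact hXP⟩
      simpa [he] using this)
    have hR := Q_left Aᴴ b a rfl hP.star (by
      intro X hX hXP
      have he : F (U, V * Xᴴ) = (X * Aᴴ)ᴴ := by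
        simp [F, hA, conjTranspose_mul, Matrix.mul_assoc]
      have := hm (a := (U, V * Xᴴ)) ⟨⟨hU, hV.mul hX.star⟩, by
        rw [Set.mem_preimage, he]; exact hXP.star⟩
      simp only [Set.mem_ofPred_eq, he, conjTranspose_apply, Quaternion.re_star] at this
      rw [conjTranspose_apply, Quaternion.re_star]
      exact this)
    intro i j hij
    by_cases hij' : (i : ℕ) < k ∨ (j : ℕ) < k
    · exact hP i j hij'
    constructor
    · intro hne
      by_cases hi : (i : ℕ) = k
      · have hia : i = a := Fin.ext hi
        have := hR.2 j (show k < (j : ℕ) by omega)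
        rw [conjTranspose_apply, star_eq_zero] at this
        rw [hia, this]
      · have hjb : j = b := Fin.ext (show (j : ℕ) = k by omega)
        rw [hjb, hL.2 i (show k < (i : ℕ) by omega)]
    · intro he
      have hia : i = a := Fin.ext (show (i : ℕ) = k by omega)
      have hjb : j = b := Fin.ext (show (j : ℕ) = k by omega)
      rw [hia, hjb]; exact hL.1

/-- Quaternion singular value decomposition (QSVD): every quaternion matrix
`Q ∈ ℍ^{M×N}` factors as `Q = U Λ Vᴴ` with `U`, `V` unitary and `Λ` a matrix that
vanishes off the diagonal and whose diagonal entries are nonnegative real scalars. -/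
theorem qsvd_exists (M N : ℕ) (Q : Matrix (Fin M) (Fin N) (Quaternion ℝ)) :
    ∃ (U : Matrix (Fin M) (Fin M) (Quaternion ℝ))
      (V : Matrix (Fin N) (Fin N) (Quaternion ℝ))
      (Λ : Matrix (Fin M) (Fin N) (Quaternion ℝ)),
      Uᴴ * U = 1 ∧ U * Uᴴ = 1 ∧
      Vᴴ * V = 1 ∧ V * Vᴴ = 1 ∧
      (∀ (i : Fin M) (j : Fin N), (i : ℕ) ≠ (j : ℕ) → Λ i j = 0) ∧
      (∀ (i : Fin M) (j : Fin N), (i : ℕ) = (j : ℕ) →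
        ∃ σ : ℝ, 0 ≤ σ ∧ Λ i j = σ • (1 : Quaternion ℝ)) ∧
      Q = U * Λ * Vᴴ := by
  obtain ⟨U, V, hU, hV, hP⟩ := Q_step Q (M + N)
  refine ⟨U, V, Uᴴ * Q * V, hU.1, hU.2, hV.1, hV.2, ?_, ?_, ?_⟩
  · intro i j hij
    exact (hP i j (Or.inl (by omega))).1 hij
  · intro i j hij
    refine ⟨_, norm_nonneg ((Uᴴ * Q * V) i j), ((hP i j (Or.inl (by omega))).2 hij).trans ?_⟩
    rw [← Quaternion.coe_mul_eq_smul, mul_one]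
  · rw [Matrix.mul_assoc U, Matrix.mul_assoc _ V, hV.2, Matrix.mul_one, ← Matrix.mul_assoc, hU.2,
      Matrix.one_mul]
end

section
/- For every quaternion matrix Q ∈ ℍ^{M×N} and for all m ∈ {0,…,M−1}, n ∈ {0,…,N−1}, one has IQDCT^L(FQDCT^L(Q))(m,n) = Q(m,n); that is, the left inverse quaternion discrete cosine transform inverts the left forward quaternion discrete cosine transform. -/
open Matrix

/-- Normalization factor of the DCT: `α(u) = √(1/M)` if `u = 0`, `√(2/M)` otherwise. -/
noncomputable def dctAlpha (M : ℕ) (u : Fin M) : ℝ :=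
  if (u : ℕ) = 0 then Real.sqrt (1 / M) else Real.sqrt (2 / M)

/-- DCT kernel `N(u,v,m,n) = cos(π(2m+1)u/(2M)) · cos(π(2n+1)v/(2N))`. -/
noncomputable def dctKer (M N : ℕ) (u : Fin M) (v : Fin N) (m : Fin M) (n : Fin N) : ℝ :=
  Real.cos (Real.pi * (2 * (m : ℝ) + 1) * (u : ℝ) / (2 * (M : ℝ))) *
    Real.cos (Real.pi * (2 * (n : ℝ) + 1) * (v : ℝ) / (2 * (N : ℝ)))

/-- Left forward quaternion discrete cosine transform:
`FQDCT^L(Q)(u,v) = α(u)β(v) Σ_m Σ_n q̇ · Q(m,n) · N(u,v,m,n)`. -/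
noncomputable def FQDCTL (M N : ℕ) (q : Quaternion ℝ)
    (Q : Matrix (Fin M) (Fin N) (Quaternion ℝ)) :
    Matrix (Fin M) (Fin N) (Quaternion ℝ) :=
  Matrix.of fun u v =>
    (dctAlpha M u * dctAlpha N v) •
      ∑ m : Fin M, ∑ n : Fin N, (dctKer M N u v m n) • (q * Q m n)

/-- Left inverse quaternion discrete cosine transform:
`IQDCT^L(C)(m,n) = Σ_u Σ_v α(u)β(v) · q̇⁻¹ · C(u,v) · N(u,v,m,n)` with `q̇⁻¹ = −q̇`. -/
noncomputable def IQDCTL (M N : ℕ) (q : Quaternion ℝ)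
    (C : Matrix (Fin M) (Fin N) (Quaternion ℝ)) :
    Matrix (Fin M) (Fin N) (Quaternion ℝ) :=
  Matrix.of fun m n =>
    ∑ u : Fin M, ∑ v : Fin N,
      (dctAlpha M u * dctAlpha N v) • ((dctKer M N u v m n) • ((-q) * C u v))

lemma dct_aux_tel (M : ℕ) (x : ℝ) :
    2 * Real.sin x * ∑ u ∈ Finset.range M, Real.cos (2 * x * u) =
      Real.sin ((2 * M - 1) * x) + Real.sin x := by
  induction M with
  | zero => simp
  | succ k ih =>
    rw [Finset.sum_range_succ, mul_add, ih]
    have h1 : (2 * ((k + 1 : ℕ) : ℝ) - 1) * x = 2 * x * k + x := by push_cast; ring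
    have h2 : (2 * (k : ℝ) - 1) * x = 2 * x * k - x := by ring
    rw [h1, h2, Real.sin_add, Real.sin_sub]
    ring

lemma dct_aux_S (M : ℕ) (hM : 1 ≤ M) (k : ℤ) (hk : k ≠ 0) (h1 : -(2 * M : ℤ) < k)
    (h2 : k < 2 * M) :
    2 * ∑ u ∈ Finset.range M, Real.cos (Real.pi * k / M * u) = 1 - Real.cos (k * Real.pi) := by
  have hM0 : (0 : ℝ) < M := by exact_mod_cast hM
  have hpi := Real.pi_pos
  have h1' : -(2 * M : ℝ) < k := by exact_mod_cast h1
  have h2' : (k : ℝ) < 2 * M := by exact_mod_cast h2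
  have hk' : (k : ℝ) ≠ 0 := by exact_mod_cast hk
  set x : ℝ := Real.pi * k / (2 * M) with hx
  have hs : Real.sin x ≠ 0 := by
    intro h
    have hx1 : -Real.pi < x := by
      rw [hx, lt_div_iff₀ (by positivity)]; nlinarith
    have hx2 : x < Real.pi := by
      rw [hx, div_lt_iff₀ (by positivity)]; nlinarith
    have := (Real.sin_eq_zero_iff_of_lt_of_lt hx1 hx2).1 h
    rw [hx] at this
    have h3 : Real.pi * k / (2 * M) ≠ 0 := by
      apply div_ne_zero (mul_ne_zero hpi.ne' hk') (by positivity)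
    exact h3 this
  have ht := dct_aux_tel M x
  have e1 : (2 * (M : ℝ) - 1) * x = k * Real.pi - x := by
    rw [hx]; field_simp
  have e2 : Real.pi * k / M = 2 * x := by rw [hx]; field_simp
  rw [e1, Real.sin_sub, Real.sin_int_mul_pi] at ht
  rw [e2]
  apply mul_left_cancel₀ hs
  linarith

lemma dct_aux_orth (M : ℕ) (hM : 1 ≤ M) (m m' : Fin M) :
    ∑ u : Fin M, dctAlpha M u ^ 2 *
      (Real.cos (Real.pi * (2 * (m : ℝ) + 1) * (u : ℝ) / (2 * (M : ℝ))) *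
       Real.cos (Real.pi * (2 * (m' : ℝ) + 1) * (u : ℝ) / (2 * (M : ℝ)))) =
      if m = m' then 1 else 0 := by
  have hM0 : (0 : ℝ) < M := by exact_mod_cast hM
  have key : ∀ u : Fin M, dctAlpha M u ^ 2 *
      (Real.cos (Real.pi * (2 * (m : ℝ) + 1) * (u : ℝ) / (2 * (M : ℝ))) *
       Real.cos (Real.pi * (2 * (m' : ℝ) + 1) * (u : ℝ) / (2 * (M : ℝ)))) =
      (fun u : ℕ => 1 / (M : ℝ) * (Real.cos (Real.pi * ((m + m' + 1 : ℤ) : ℝ) / M * u) +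
        Real.cos (Real.pi * ((m - m' : ℤ) : ℝ) / M * u) - if u = 0 then 1 else 0)) u := by
    intro u
    have ea : Real.pi * ((m + m' + 1 : ℤ) : ℝ) / M * (u : ℕ) =
      Real.pi * (2 * (m : ℝ) + 1) * (u : ℝ) / (2 * (M : ℝ)) +
      Real.pi * (2 * (m' : ℝ) + 1) * (u : ℝ) / (2 * (M : ℝ)) := by
      push_cast; field_simp; ring
    have eb : Real.pi * ((m - m' : ℤ) : ℝ) / M * (u : ℕ) =
      Real.pi * (2 * (m : ℝ) + 1) * (u : ℝ) / (2 * (M : ℝ)) -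
      Real.pi * (2 * (m' : ℝ) + 1) * (u : ℝ) / (2 * (M : ℝ)) := by
      push_cast; field_simp; ring
    simp only []
    rw [ea, eb, Real.cos_add, Real.cos_sub]
    unfold dctAlpha
    by_cases hu : (u : ℕ) = 0
    · rw [if_pos hu, if_pos hu, Real.sq_sqrt (by positivity)]
      simp [hu]
    · rw [if_neg hu, if_neg hu, Real.sq_sqrt (by positivity)]
      ring
  rw [Finset.sum_congr rfl (fun u _ => key u), Fin.sum_univ_eq_sum_range
    (fun u : ℕ => 1 / (M : ℝ) * (Real.cos (Real.pi * ((m + m' + 1 : ℤ) : ℝ) / M * u) +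
        Real.cos (Real.pi * ((m - m' : ℤ) : ℝ) / M * u) - if u = 0 then 1 else 0)),
    ← Finset.mul_sum, Finset.sum_sub_distrib, Finset.sum_add_distrib, Finset.sum_ite_eq',
    if_pos (Finset.mem_range.2 hM)]
  have hm := m.2
  have hm' := m'.2
  have hA := dct_aux_S M hM (m + m' + 1 : ℤ) (by omega) (by omega) (by omega)
  have cA : Real.cos (((m + m' + 1 : ℤ) : ℝ) * Real.pi) =
      - Real.cos (((m - m' : ℤ) : ℝ) * Real.pi) := by
    have : ((m + m' + 1 : ℤ) : ℝ) * Real.pi =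
      (((m - m' : ℤ) : ℝ) * Real.pi + (m' : ℕ) * (2 * Real.pi)) + Real.pi := by
      push_cast; ring
    rw [this, Real.cos_add_pi, Real.cos_add_nat_mul_two_pi]
  rw [cA] at hA
  by_cases h : m = m'
  · subst h
    simp only [sub_self, Int.cast_zero, zero_mul, mul_zero, zero_div, Real.cos_zero,
      Finset.sum_const, Finset.card_range, nsmul_eq_mul, mul_one, if_true] at hA ⊢
    have : ∑ u ∈ Finset.range M, Real.cos (Real.pi * ((m + m + 1 : ℤ) : ℝ) / M * u) = 1 := by
      linarith
    rw [this]; field_simp; ring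
  · have hne : (m : ℕ) ≠ m' := fun e => h (Fin.ext e)
    have hB := dct_aux_S M hM (m - m' : ℤ) (by omega) (by omega) (by omega)
    rw [if_neg h]
    apply mul_eq_zero_of_right
    linarith

/-- The left inverse quaternion discrete cosine transform inverts the left
forward quaternion discrete cosine transform. -/
theorem iqdctL_fqdctL (M N : ℕ) (hM : 1 ≤ M) (hN : 1 ≤ N)
    (q : Quaternion ℝ) (hre : q.re = 0) (hq : q ^ 2 = -1)
    (Q : Matrix (Fin M) (Fin N) (Quaternion ℝ)) (m : Fin M) (n : Fin N) :
    IQDCTL M N q (FQDCTL M N q Q) m n = Q m n := by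
  have hqq : ∀ x : Quaternion ℝ, (-q) * (q * x) = x := by
    intro x
    rw [← mul_assoc, neg_mul, ← sq, hq, neg_neg, one_mul]
  simp only [IQDCTL, FQDCTL, Matrix.of_apply, mul_smul_comm, Finset.mul_sum, hqq,
    Finset.smul_sum, smul_smul]
  have hsw : ∀ f : Fin M → Fin N → Fin M → Fin N → Quaternion ℝ,
      ∑ u, ∑ v, ∑ a, ∑ b, f u v a b = ∑ a, ∑ b, ∑ u, ∑ v, f u v a b := by
    intro f
    calc _ = ∑ u, ∑ a, ∑ v, ∑ b, f u v a b :=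
          Finset.sum_congr rfl fun u _ => Finset.sum_comm
      _ = ∑ a, ∑ u, ∑ v, ∑ b, f u v a b := Finset.sum_comm
      _ = ∑ a, ∑ u, ∑ b, ∑ v, f u v a b :=
          Finset.sum_congr rfl fun a _ => Finset.sum_congr rfl fun u _ => Finset.sum_comm
      _ = _ := Finset.sum_congr rfl fun a _ => Finset.sum_comm
  rw [hsw]
  simp only [← Finset.sum_smul]
  have hc : ∀ a b, ∑ u, ∑ v, dctAlpha M u * dctAlpha N v * (dctKer M N u v m n *
      (dctAlpha M u * dctAlpha N v * dctKer M N u v a b)) =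
      (if m = a then 1 else 0) * (if n = b then 1 else 0) := by
    intro a b
    rw [← dct_aux_orth M hM m a, ← dct_aux_orth N hN n b, Finset.sum_mul_sum]
    refine Finset.sum_congr rfl fun u _ => Finset.sum_congr rfl fun v _ => ?_
    unfold dctKer
    ring
  simp only [mul_assoc] at hc ⊢
  simp only [hc]
  simp [ite_smul, Finset.sum_ite_eq]
end
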